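/- arXiv:2509.19561 — 2 statements merged into one kernel-verified Lean document; each statement's English description precedes it below -/
import Mathlib

section
/- Assume in addition β_k = η √(s_k)/2 for some η ∈ (0,1] and Assumption (J0). Then there exists a constant C > 0 such that for all k large enough, f(x_k) − min f ≤ C/(s_k k²); that is, f(x_k) − min f = O(1/(s_k k²)) as k → ∞. -/
set_option autoImplicit false

open Filter

section Convex

variable {H : Type*} [NormedAddCommGroup H] [InnerProductSpace ℝ H] [CompleteSpace H]
  {f : H → ℝ} {f' : H → H}

theorem HasGradientAt.hasDerivAt_comp_add_smul {a g : H} (d : H) {t : ℝ}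
    (h : HasGradientAt f g (a + t • d)) :
    HasDerivAt (fun t : ℝ => f (a + t • d)) (inner ℝ g d) t := by
  have hd : HasDerivAt (fun t : ℝ => a + t • d) d t := by
    simpa using ((hasDerivAt_id t).smul_const d).const_add a
  exact (h.hasFDerivAt.comp_hasDerivAt t hd).congr_deriv (by simp)

theorem ConvexOn.add_inner_le_of_hasGradientAt (hconv : ConvexOn ℝ Set.univ f) {a g : H}
    (h : HasGradientAt f g a) (b : H) : f a + inner ℝ g (b - a) ≤ f b := by
  have hc : ConvexOn ℝ Set.univ (fun t : ℝ => f (a + t • (b - a))) := by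
    have := hconv.comp_affineMap (AffineMap.lineMap a b : ℝ →ᵃ[ℝ] H)
    simpa [Function.comp_def, AffineMap.lineMap_apply, add_comm] using this
  have hd : HasDerivAt (fun t : ℝ => f (a + t • (b - a))) (inner ℝ g (b - a)) 0 :=
    HasGradientAt.hasDerivAt_comp_add_smul (b - a) (by simpa using h)
  have := hc.le_slope_of_hasDerivAt (Set.mem_univ 0) (Set.mem_univ 1) one_pos hd
  simp [slope_def_field] at this
  linarith

/-- The descent lemma for functions with `L`-Lipschitz gradient. -/
theorem le_add_inner_add_norm_sq_of_lipschitz_gradient {L : ℝ}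
    (hdiff : ∀ z, HasGradientAt f (f' z) z) (hlip : ∀ z w, ‖f' z - f' w‖ ≤ L * ‖z - w‖) (a b : H) :
    f b ≤ f a + inner ℝ (f' a) (b - a) + L / 2 * ‖b - a‖ ^ 2 := by
  set d := b - a with hd
  have hder : ∀ t : ℝ, HasDerivAt
      (fun t : ℝ => f (a + t • d) - t * inner ℝ (f' a) d - L / 2 * ‖d‖ ^ 2 * t ^ 2)
      (inner ℝ (f' (a + t • d)) d - inner ℝ (f' a) d - L / 2 * ‖d‖ ^ 2 * (2 * t)) t := by
    intro t
    have h1 := (hdiff (a + t • d)).hasDerivAt_comp_add_smul d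
    have h2 := (hasDerivAt_id t).mul_const (inner ℝ (f' a) d)
    have h3 := ((hasDerivAt_id t).pow 2).const_mul (L / 2 * ‖d‖ ^ 2)
    exact ((h1.sub h2).sub h3).congr_deriv (by simp)
  have hanti := antitoneOn_of_deriv_nonpos (convex_Icc (0 : ℝ) 1)
    (fun t _ => (hder t).continuousAt.continuousWithinAt)
    (fun t _ => (hder t).differentiableAt.differentiableWithinAt)
    (fun t ht => by
      rw [interior_Icc] at ht
      rw [(hder t).deriv, ← inner_sub_left]
      have h1 := real_inner_le_norm (f' (a + t • d) - f' a) d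
      have h2 := hlip (a + t • d) a
      rw [add_sub_cancel_left, norm_smul, Real.norm_of_nonneg ht.1.le] at h2
      have h3 := mul_le_mul_of_nonneg_right h2 (norm_nonneg d)
      nlinarith)
  have := hanti (Set.left_mem_Icc.2 zero_le_one) (Set.right_mem_Icc.2 zero_le_one) zero_le_one
  simp only [zero_smul, add_zero, one_smul, zero_mul, one_mul] at this
  rw [hd, add_sub_cancel, ← hd] at this
  linarith

theorem ConvexOn.add_inner_add_norm_sq_le_of_lipschitz_gradient {L : ℝ} (hL : 0 < L)
    (hconv : ConvexOn ℝ Set.univ f) (hdiff : ∀ z, HasGradientAt f (f' z) z)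
    (hlip : ∀ z w, ‖f' z - f' w‖ ≤ L * ‖z - w‖) (a b : H) :
    f a + inner ℝ (f' a) (b - a) + 1 / (2 * L) * ‖f' a - f' b‖ ^ 2 ≤ f b := by
  set e := f' b - f' a with he
  have h1 := hconv.add_inner_le_of_hasGradientAt (hdiff a) (b - (1 / L) • e)
  have h2 := le_add_inner_add_norm_sq_of_lipschitz_gradient hdiff hlip b (b - (1 / L) • e)
  have h3 : b - (1 / L) • e - a = (b - a) - (1 / L) • e := by abel
  have h4 : b - (1 / L) • e - b = -((1 / L) • e) := by abel
  have h5 : inner ℝ (f' b) e - inner ℝ (f' a) e = ‖e‖ ^ 2 := by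
    rw [← inner_sub_left, ← he, real_inner_self_eq_norm_sq]
  rw [h3, inner_sub_right, inner_smul_right] at h1
  rw [h4, inner_neg_right, inner_smul_right, norm_neg, norm_smul, mul_pow,
    Real.norm_of_nonneg (by positivity)] at h2
  rw [norm_sub_rev, ← he]
  have h6 : L / 2 * ((1 / L) ^ 2 * ‖e‖ ^ 2) = 1 / L * ‖e‖ ^ 2 - 1 / (2 * L) * ‖e‖ ^ 2 := by
    field_simp; ring
  rw [h6, ← h5] at h2
  rw [← h5]
  linarith

/-- Decrease of the function values along one inexact gradient step, compared with any point. -/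
theorem ConvexOn.inexact_gradient_step_le {L s : ℝ} (hL : 0 < L) (hs : 0 < s) (hsL : s ≤ 1 / L)
    (hconv : ConvexOn ℝ Set.univ f) (hdiff : ∀ z, HasGradientAt f (f' z) z)
    (hlip : ∀ z w, ‖f' z - f' w‖ ≤ L * ‖z - w‖) (x y m : H) :
    f (y - s • (f' y + m)) ≤ f x + inner ℝ (f' y) (y - x) - s / 2 * ‖f' y‖ ^ 2
      - s / 2 * ‖f' y - f' x‖ ^ 2 + s / 2 * ‖m‖ ^ 2 := by
  have h1 := hconv.add_inner_add_norm_sq_le_of_lipschitz_gradient hL hdiff hlip y x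
  have h2 := le_add_inner_add_norm_sq_of_lipschitz_gradient hdiff hlip y (y - s • (f' y + m))
  have h3 : y - s • (f' y + m) - y = -(s • (f' y + m)) := by abel
  rw [h3, inner_neg_right, inner_smul_right, inner_add_right, norm_neg, norm_smul, mul_pow,
    Real.norm_of_nonneg hs.le, real_inner_self_eq_norm_sq, norm_add_sq_real] at h2
  rw [← neg_sub y x, inner_neg_right] at h1
  have hLs : L * s ≤ 1 := by rw [le_div_iff₀ hL] at hsL; linarith
  have h4 : s / 2 * ‖f' y - f' x‖ ^ 2 ≤ 1 / (2 * L) * ‖f' y - f' x‖ ^ 2 := by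
    apply mul_le_mul_of_nonneg_right _ (sq_nonneg _)
    rw [one_div, mul_inv, ← one_div L]
    linarith
  have h5 : 0 ≤ (1 - L * s) * s / 2 * ‖f' y + m‖ ^ 2 := by
    have : 0 ≤ 1 - L * s := by linarith
    positivity
  rw [norm_add_sq_real] at h5
  linarith

/-- One-step estimate for the Lyapunov function of the inexact accelerated gradient method with
Hessian-driven damping. -/
theorem ConvexOn.igahd_energy_step {L s α η κ : ℝ} (hL : 0 < L) (hs : 0 < s) (hsL : s ≤ 1 / L)
    (hconv : ConvexOn ℝ Set.univ f) (hdiff : ∀ z, HasGradientAt f (f' z) z)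
    (hlip : ∀ z w, ‖f' z - f' w‖ ≤ L * ‖z - w‖)
    (hα : 1 ≤ α) (hη0 : 0 < η) (hη1 : η ≤ 1) (hκ0 : 0 < κ) (hκ : 2 * (α - 1) ≤ κ)
    (p x y mx my u : H)
    (hu : u = (α - 1) • (x - p) + κ • (y - x + (η * s / 2) • (f' x + mx))) :
    κ ^ 2 * s * (f (y - s • (f' y + my)) - f p) + 1 / 2 * ‖u - (κ * s) • (f' y + my)‖ ^ 2 ≤
      κ * (κ - α + 1) * s * (f x - f p) + 1 / 2 * ‖u‖ ^ 2 + κ * s * ‖my‖ * ‖u‖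
        + (2 / η + 1) * (s * κ * ‖my‖) ^ 2 + η / 2 * (s * κ * ‖mx‖) ^ 2 := by
  have hA := hconv.inexact_gradient_step_le hL hs hsL hdiff hlip x y my
  have hB := hconv.inexact_gradient_step_le hL hs hsL hdiff hlip p y my
  have hB' : 0 ≤ s / 2 * ‖f' y - f' p‖ ^ 2 := by positivity
  set F := f (y - s • (f' y + my))
  set h := f' y
  set g := f' x
  have hV : inner ℝ h my ≤ ‖h‖ * ‖my‖ := real_inner_le_norm _ _
  have hT : -(‖h‖ * ‖mx‖) ≤ inner ℝ h mx := neg_le_of_abs_le (abs_real_inner_le_norm _ _)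
  have hW : -(‖my‖ * ‖u‖) ≤ inner ℝ my u := neg_le_of_abs_le (abs_real_inner_le_norm _ _)
  have hyp : y - p = (x - p) + (y - x) := by abel
  have hhu : inner ℝ h u = (α - 1) * inner ℝ h (x - p)
      + κ * (inner ℝ h (y - x) + η * s / 2 * (inner ℝ h g + inner ℝ h mx)) := by
    rw [hu]; simp only [inner_add_right, inner_smul_right]
  have hnorm : ‖u - (κ * s) • (h + my)‖ ^ 2 = ‖u‖ ^ 2
      - 2 * (κ * s) * (inner ℝ h u + inner ℝ my u)
      + (κ * s) ^ 2 * (‖h‖ ^ 2 + 2 * inner ℝ h my + ‖my‖ ^ 2) := by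
    rw [norm_sub_sq_real, inner_smul_right, inner_add_right, norm_smul, mul_pow, norm_add_sq_real,
      Real.norm_of_nonneg (by positivity), real_inner_comm, real_inner_comm my u]
    ring
  rw [hnorm]
  rw [hyp, inner_add_right] at hB
  have hsq : ‖h - g‖ ^ 2 = ‖h‖ ^ 2 - 2 * inner ℝ h g + ‖g‖ ^ 2 := norm_sub_sq_real h g
  have hcomb : κ * (F - f p) ≤ (κ - α + 1) * (f x - f p) + inner ℝ h u
      - κ * (η * s / 2) * (inner ℝ h g + inner ℝ h mx) - κ * s / 2 * ‖h‖ ^ 2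
      - (κ - α + 1) * (s / 2 * ‖h - g‖ ^ 2) + κ * s / 2 * ‖my‖ ^ 2 := by
    have hA' := mul_le_mul_of_nonneg_left hA (show 0 ≤ κ - α + 1 by linarith)
    have hB'' := mul_le_mul_of_nonneg_left (hB.trans (by linarith :
      _ ≤ f p + (inner ℝ h (x - p) + inner ℝ h (y - x)) - s / 2 * ‖h‖ ^ 2 + s / 2 * ‖my‖ ^ 2))
      (show 0 ≤ α - 1 by linarith)
    rw [hhu]
    linarith
  have hdiss : κ * s * η / 4 * ‖h‖ ^ 2 ≤ κ * (η * s / 2) * inner ℝ h g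
      + (κ - α + 1) * (s / 2 * ‖h - g‖ ^ 2) := by
    have h1 : κ * s * η / 4 * ‖h - g‖ ^ 2 ≤ (κ - α + 1) * (s / 2 * ‖h - g‖ ^ 2) := by
      rw [← mul_assoc]
      apply mul_le_mul_of_nonneg_right _ (sq_nonneg _)
      have : κ * η ≤ κ := by nlinarith
      nlinarith
    have h2 : 0 ≤ κ * s * η / 4 * ‖g‖ ^ 2 := by positivity
    rw [hsq] at h1 ⊢
    linarith
  have hks : 0 < κ * s := by positivity
  have hcomb2 := mul_le_mul_of_nonneg_left (hcomb.trans (by linarith :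
    _ ≤ (κ - α + 1) * (f x - f p) + inner ℝ h u - κ * (η * s / 2) * inner ℝ h mx
      - κ * s * η / 4 * ‖h‖ ^ 2 - κ * s / 2 * ‖h‖ ^ 2 + κ * s / 2 * ‖my‖ ^ 2)) hks.le
  have hV' := mul_le_mul_of_nonneg_left hV (sq_nonneg (κ * s))
  have hT' := mul_le_mul_of_nonneg_left hT (show 0 ≤ (κ * s) ^ 2 * (η / 2) by positivity)
  have hW' := mul_le_mul_of_nonneg_left hW hks.le
  have young1 : (κ * s) ^ 2 * (‖h‖ * ‖my‖) ≤
      η / 8 * (κ * s * ‖h‖) ^ 2 + 2 / η * (s * κ * ‖my‖) ^ 2 := by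
    have : 0 ≤ 2 / η * (η / 4 * (κ * s * ‖h‖) - s * κ * ‖my‖) ^ 2 := by positivity
    have e : 2 / η * (η / 4 * (κ * s * ‖h‖) - s * κ * ‖my‖) ^ 2 =
      η / 8 * (κ * s * ‖h‖) ^ 2 + 2 / η * (s * κ * ‖my‖) ^ 2 - (κ * s) ^ 2 * (‖h‖ * ‖my‖) := by
      field_simp; ring
    linarith
  have young2 : (κ * s) ^ 2 * (η / 2) * (‖h‖ * ‖mx‖) ≤
      η / 8 * (κ * s * ‖h‖) ^ 2 + η / 2 * (s * κ * ‖mx‖) ^ 2 := by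
    have : 0 ≤ η / 8 * (κ * s * ‖h‖ - 2 * (s * κ * ‖mx‖)) ^ 2 := by positivity
    linarith
  linarith

end Convex

theorem exists_le_of_le_one_add_mul_add {E a b : ℕ → ℝ} (N : ℕ) (hE : ∀ k, 0 ≤ E k)
    (ha0 : ∀ k, 0 ≤ a k) (hb0 : ∀ k, 0 ≤ b k) (ha : Summable a) (hb : Summable b)
    (h : ∀ k, N ≤ k → E (k + 1) ≤ (1 + a k) * E k + b k) : ∃ C, ∀ k, N ≤ k → E k ≤ C := by
  have key : ∀ k, N ≤ k →
      E k + 1 ≤ (E N + 1) * Real.exp (∑ i ∈ Finset.range k, (a i + b i)) := by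
    intro k hk
    induction k, hk using Nat.le_induction with
    | base =>
      exact le_mul_of_one_le_right (by linarith [hE N]) <| Real.one_le_exp <|
        Finset.sum_nonneg fun i _ => add_nonneg (ha0 i) (hb0 i)
    | succ k hk ih =>
      rw [Finset.sum_range_succ, Real.exp_add, ← mul_assoc]
      calc E (k + 1) + 1 ≤ (E k + 1) * (a k + b k + 1) := by
            nlinarith [h k hk, hE k, ha0 k, hb0 k, mul_nonneg (hE k) (hb0 k)]
        _ ≤ _ := mul_le_mul ih (Real.add_one_le_exp _) (by linarith [ha0 k, hb0 k])
            (by have := hE N; positivity)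
  refine ⟨(E N + 1) * Real.exp (∑' i, (a i + b i)), fun k hk => ?_⟩
  have h1 := key k hk
  have h2 : ∑ i ∈ Finset.range k, (a i + b i) ≤ ∑' i, (a i + b i) :=
    (ha.add hb).sum_le_tsum _ fun i _ => add_nonneg (ha0 i) (hb0 i)
  have h3 := mul_le_mul_of_nonneg_left (Real.exp_le_exp.2 h2) (by linarith [hE N] : 0 ≤ E N + 1)
  linarith

theorem Summable.sq_of_nonneg {a : ℕ → ℝ} (ha : Summable a) (h0 : ∀ k, 0 ≤ a k) :
    Summable fun k => a k ^ 2 := by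
  refine Summable.of_nonneg_of_le (fun k => sq_nonneg _) (fun k => ?_) (ha.mul_left (∑' i, a i))
  rw [sq]
  exact mul_le_mul_of_nonneg_right (ha.le_tsum k fun i _ => h0 i) (h0 k)

/-- Theorem 2.1(i): fast convergence of the objective values,
`f(x_k) − min f = O(1/(s_k k²))` as `k → ∞`. -/
theorem igahd_values_rate
    {H : Type*} [NormedAddCommGroup H] [InnerProductSpace ℝ H] [CompleteSpace H]
    (f : H → ℝ) (f' : H → H) (L : ℝ) (hL : 0 < L)
    (hconv : ConvexOn ℝ Set.univ f)
    (hdiff : ∀ z, HasGradientAt f (f' z) z)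
    (hlip : ∀ z w, ‖f' z - f' w‖ ≤ L * ‖z - w‖)
    (xstar : H) (hmin : ∀ z, f xstar ≤ f z)
    (α : ℝ) (hα : 3 ≤ α)
    (s β : ℕ → ℝ) (hs0 : s 0 = 0) (hβ0 : β 0 = 0)
    (hs_pos : ∀ k, 1 ≤ k → 0 < s k) (hs_le : ∀ k, 1 ≤ k → s k ≤ 1 / L)
    (hs_dec : ∀ k, 1 ≤ k → s (k + 1) ≤ s k)
    (η : ℝ) (hη0 : 0 < η) (hη1 : η ≤ 1)
    (hβ : ∀ k, 1 ≤ k → β k = η * Real.sqrt (s k) / 2)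
    (x y Mx My : ℕ → H)
    (hx_init : x 1 = x 0)
    (hy : ∀ k, 1 ≤ k → y k = x k + (1 - α / (k : ℝ)) • (x k - x (k - 1))
        - (β k * Real.sqrt (s k)) • (f' (x k) + Mx k)
        + (β (k - 1) * Real.sqrt (s (k - 1)) * (1 - 1 / (k : ℝ))) •
            (f' (x (k - 1)) + Mx (k - 1)))
    (hx : ∀ k, 1 ≤ k → x (k + 1) = y k - s k • (f' (y k) + My k))
    (hJ0x : Summable fun k : ℕ => s k * (k : ℝ) * ‖Mx k‖)
    (hJ0y : Summable fun k : ℕ => s k * (k : ℝ) * ‖My k‖) :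
    ∃ C : ℝ, 0 < C ∧ ∃ N : ℕ, ∀ k, N ≤ k →
      f (x k) - f xstar ≤ C / (s k * (k : ℝ) ^ 2) := by
  have hs_nonneg : ∀ k, 0 ≤ s k := fun k => by
    rcases Nat.eq_zero_or_pos k with rfl | hk
    · exact hs0.ge
    · exact (hs_pos k hk).le
  have hb : ∀ k, β k * Real.sqrt (s k) = η * s k / 2 := fun k => by
    rcases Nat.eq_zero_or_pos k with rfl | hk
    · simp [hs0]
    · rw [hβ k hk]
      linear_combination η / 2 * Real.mul_self_sqrt (hs_nonneg k)
  set u : ℕ → H := fun k => (α - 1) • (x k - xstar)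
    + (k : ℝ) • (y k - x k + (η * s k / 2) • (f' (x k) + Mx k)) with hu
  have hu_succ : ∀ k, 1 ≤ k → u (k + 1) = u k - ((k : ℝ) * s k) • (f' (y k) + My k) := by
    intro k hk
    have hy' := hy (k + 1) (by omega)
    rw [hb, hb, Nat.add_sub_cancel] at hy'
    have hk1 : ((k + 1 : ℕ) : ℝ) ≠ 0 := by positivity
    have hstep : s k • (f' (y k) + My k) = y k - x (k + 1) := by rw [hx k hk]; abel
    have hmom : ((k + 1 : ℕ) : ℝ) • (y (k + 1) - x (k + 1)
        + (η * s (k + 1) / 2) • (f' (x (k + 1)) + Mx (k + 1)))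
        = ((k : ℝ) + 1 - α) • (x (k + 1) - x k)
          + ((k : ℝ) * (η * s k / 2)) • (f' (x k) + Mx k) := by
      have e1 : (k : ℝ) + 1 - α = ((k + 1 : ℕ) : ℝ) * (1 - α / ((k + 1 : ℕ) : ℝ)) := by
        rw [mul_sub, mul_div_cancel₀ _ hk1]; push_cast; ring
      have e2 : (k : ℝ) * (η * s k / 2)
          = ((k + 1 : ℕ) : ℝ) * (η * s k / 2 * (1 - 1 / ((k + 1 : ℕ) : ℝ))) := by
        field_simp; push_cast; ring
      rw [hy', e1, e2]
      module
    simp only [hu]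
    rw [hmom, mul_smul (k : ℝ) (s k), hstep]
    module
  set E : ℕ → ℝ := fun k => ((k : ℝ) - 1) ^ 2 * s (k - 1) * (f (x k) - f xstar)
    + 1 / 2 * ‖u k‖ ^ 2 with hE
  have hgap : ∀ z, 0 ≤ f z - f xstar := fun z => sub_nonneg.2 (hmin z)
  have hE0 : ∀ k, 0 ≤ E k := fun k => by
    have := hs_nonneg (k - 1)
    have := hgap (x k)
    positivity
  have hp0 : ∀ k, 0 ≤ s k * (k : ℝ) * ‖My k‖ := fun k => by have := hs_nonneg k; positivity
  have hq0 : ∀ k, 0 ≤ s k * (k : ℝ) * ‖Mx k‖ := fun k => by have := hs_nonneg k; positivity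
  obtain ⟨N, hN⟩ := exists_nat_ge (2 * (α - 1))
  have hrec : ∀ k, N + 2 ≤ k → E (k + 1) ≤ (1 + s k * (k : ℝ) * ‖My k‖) * E k
      + (s k * (k : ℝ) * ‖My k‖ + ((2 / η + 1) * (s k * (k : ℝ) * ‖My k‖) ^ 2
        + η / 2 * (s k * (k : ℝ) * ‖Mx k‖) ^ 2)) := by
    intro k hk
    have hk2 : (N : ℝ) + 2 ≤ k := by exact_mod_cast hk
    have hN0 : (0 : ℝ) ≤ N := N.cast_nonneg
    have hstep := hconv.igahd_energy_step hL (hs_pos k (by omega)) (hs_le k (by omega)) hdiff hlip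
      (by linarith) hη0 hη1 (by linarith : (0 : ℝ) < k) (by linarith) xstar (x k) (y k)
      (Mx k) (My k) (u k) rfl
    rw [← hx k (by omega), ← hu_succ k (by omega)] at hstep
    have hsk : s k ≤ s (k - 1) := by
      have := hs_dec (k - 1) (by omega)
      rwa [Nat.sub_add_cancel (by omega)] at this
    have hcoef : (k : ℝ) * (k - α + 1) * s k * (f (x k) - f xstar) ≤
        ((k : ℝ) - 1) ^ 2 * s (k - 1) * (f (x k) - f xstar) := by
      refine mul_le_mul_of_nonneg_right ?_ (hgap _)
      calc (k : ℝ) * (k - α + 1) * s k ≤ ((k : ℝ) - 1) ^ 2 * s k :=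
            mul_le_mul_of_nonneg_right (by nlinarith) (hs_nonneg k)
        _ ≤ _ := mul_le_mul_of_nonneg_left hsk (sq_nonneg _)
    have hE' : E k = ((k : ℝ) - 1) ^ 2 * s (k - 1) * (f (x k) - f xstar)
      + 1 / 2 * ‖u k‖ ^ 2 := rfl
    have hEs : E (k + 1) = (k : ℝ) ^ 2 * s k * (f (x (k + 1)) - f xstar)
        + 1 / 2 * ‖u (k + 1)‖ ^ 2 := by
      simp [hE]
    have huE : ‖u k‖ ≤ 1 + E k := by
      have h1 : 0 ≤ ((k : ℝ) - 1) ^ 2 * s (k - 1) * (f (x k) - f xstar) := by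
        have := hs_nonneg (k - 1)
        have := hgap (x k)
        positivity
      nlinarith [sq_nonneg (‖u k‖ - 1)]
    have h2 := mul_le_mul_of_nonneg_left huE (hp0 k)
    rw [hEs]
    linarith
  obtain ⟨C, hC⟩ := exists_le_of_le_one_add_mul_add (N + 2) hE0 hp0
    (fun k => by have := hp0 k; positivity) hJ0y
    (hJ0y.add (((hJ0y.sq_of_nonneg hp0).mul_left _).add ((hJ0x.sq_of_nonneg hq0).mul_left _))) hrec
  have hC0 : 0 ≤ C := (hE0 (N + 2)).trans (hC _ le_rfl)
  refine ⟨4 * C + 1, by linarith, N + 2, fun k hk => ?_⟩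
  have hk2 : (2 : ℝ) ≤ k := by exact_mod_cast (by omega : 2 ≤ k)
  have hsk0 := hs_pos k (by omega)
  have hsk : s k ≤ s (k - 1) := by
    have := hs_dec (k - 1) (by omega)
    rwa [Nat.sub_add_cancel (by omega)] at this
  rw [le_div_iff₀ (by positivity)]
  have h1 : ((k : ℝ) - 1) ^ 2 * s (k - 1) * (f (x k) - f xstar) ≤ C := by
    have h2 : ((k : ℝ) - 1) ^ 2 * s (k - 1) * (f (x k) - f xstar) + 1 / 2 * ‖u k‖ ^ 2 ≤ C := hC k hk
    have : 0 ≤ 1 / 2 * ‖u k‖ ^ 2 := by positivity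
    linarith
  have h3 : s k * (k : ℝ) ^ 2 ≤ 4 * (((k : ℝ) - 1) ^ 2 * s (k - 1)) := by
    calc s k * (k : ℝ) ^ 2 ≤ s (k - 1) * (4 * ((k : ℝ) - 1) ^ 2) :=
          mul_le_mul hsk (by nlinarith) (by positivity) (hs_nonneg _)
      _ = _ := by ring
  have h4 := mul_le_mul_of_nonneg_right h3 (hgap (x k))
  linarith
end

section
/- Assume in addition that α > 3, the step-size is constant s_k ≡ s ∈ (0, 1/L], β_k ≡ β = η √s/2 for some η ∈ (0,1], and Assumption (J0) holds. Then sup_{k≥1} k ‖x_k − x_{k−1}‖ < ∞. -/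
set_option autoImplicit false

section Smooth

variable {H : Type*} [NormedAddCommGroup H] [InnerProductSpace ℝ H] [CompleteSpace H]
  {f : H → ℝ} {f' : H → H}

theorem hasDerivAt_comp_line (hdiff : ∀ z, HasGradientAt f (f' z) z) (y d : H) (t : ℝ) :
    HasDerivAt (fun t : ℝ => f (y + t • d)) (inner ℝ (f' (y + t • d)) d) t := by
  have hl : HasDerivAt (fun t : ℝ => y + t • d) d t := by
    simpa using ((hasDerivAt_id t).smul_const d).const_add y
  simpa [Function.comp_def] using (hdiff (y + t • d)).hasFDerivAt.comp_hasDerivAt t hl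

theorem ConvexOn.add_inner_gradient_le (hconv : ConvexOn ℝ Set.univ f)
    (hdiff : ∀ z, HasGradientAt f (f' z) z) (y w : H) :
    f y + inner ℝ (f' y) (w - y) ≤ f w := by
  have hc : ConvexOn ℝ Set.univ (fun t : ℝ => f (y + t • (w - y))) := by
    have h := hconv.comp_affineMap (AffineMap.lineMap (k := ℝ) y w)
    simpa [Function.comp_def, AffineMap.lineMap_apply, add_comm] using h
  have h := hc.le_slope_of_hasDerivAt (Set.mem_univ (0 : ℝ)) (Set.mem_univ 1) one_pos
    (hasDerivAt_comp_line hdiff y (w - y) 0)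
  simp [slope_def_field] at h
  linarith

theorem descent_of_lipschitz_gradient {L : ℝ} (hdiff : ∀ z, HasGradientAt f (f' z) z)
    (hlip : ∀ z w, ‖f' z - f' w‖ ≤ L * ‖z - w‖) (x w : H) :
    f w ≤ f x + inner ℝ (f' x) (w - x) + L / 2 * ‖w - x‖ ^ 2 := by
  set d := w - x with hd
  have hB : ∀ t : ℝ, HasDerivAt
      (fun t : ℝ => f x + t * inner ℝ (f' x) d + L / 2 * ‖d‖ ^ 2 * t ^ 2)
      (inner ℝ (f' x) d + L * ‖d‖ ^ 2 * t) t := by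
    intro t
    refine ((((hasDerivAt_id t).mul_const (inner ℝ (f' x) d)).const_add (f x)).add
      (((hasDerivAt_id t).pow 2).const_mul (L / 2 * ‖d‖ ^ 2))).congr_deriv ?_
    simp
    ring
  have h := image_le_of_deriv_right_le_deriv_boundary (a := 0) (b := 1)
    (f := fun t : ℝ => f (x + t • d))
    (fun t _ => (hasDerivAt_comp_line hdiff x d t).continuousAt.continuousWithinAt)
    (fun t _ => (hasDerivAt_comp_line hdiff x d t).hasDerivWithinAt)
    (B := fun t : ℝ => f x + t * inner ℝ (f' x) d + L / 2 * ‖d‖ ^ 2 * t ^ 2)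
    (by simp)
    (fun t _ => (hB t).continuousAt.continuousWithinAt)
    (fun t _ => (hB t).hasDerivWithinAt)
    (by
      intro t ht
      have h1 := real_inner_le_norm (f' (x + t • d) - f' x) d
      have h2 := hlip (x + t • d) x
      rw [add_sub_cancel_left, norm_smul, Real.norm_of_nonneg ht.1] at h2
      rw [inner_sub_left] at h1
      nlinarith [mul_le_mul_of_nonneg_right h2 (norm_nonneg d)])
    (Set.right_mem_Icc.2 zero_le_one)
  simpa [hd] using h

/-- The gradient inequality for a convex function with `L`-Lipschitz gradient, strengthened by
the co-coercivity term. -/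
theorem ConvexOn.add_inner_gradient_add_sq_le {L s : ℝ} (hs : 0 ≤ s) (hsL : s * L ≤ 1)
    (hconv : ConvexOn ℝ Set.univ f) (hdiff : ∀ z, HasGradientAt f (f' z) z)
    (hlip : ∀ z w, ‖f' z - f' w‖ ≤ L * ‖z - w‖) (x y : H) :
    f y ≤ f x + inner ℝ (f' y) (y - x) - s / 2 * ‖f' y - f' x‖ ^ 2 := by
  set D := f' y - f' x with hD
  have h1 := hconv.add_inner_gradient_le hdiff y (x + s • D)
  have h2 := descent_of_lipschitz_gradient hdiff hlip x (x + s • D)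
  have e1 : inner ℝ (f' y) (x + s • D - y) = s * inner ℝ (f' y) D - inner ℝ (f' y) (y - x) := by
    rw [show x + s • D - y = s • D - (y - x) by abel, inner_sub_right, real_inner_smul_right]
  have e2 : inner ℝ (f' y) D - inner ℝ (f' x) D = ‖D‖ ^ 2 := by
    rw [← inner_sub_left, ← hD, real_inner_self_eq_norm_sq]
  rw [add_sub_cancel_left, real_inner_smul_right, norm_smul, Real.norm_of_nonneg hs] at h2
  rw [e1] at h1
  nlinarith [mul_nonneg (mul_nonneg hs (sub_nonneg.2 hsL)) (sq_nonneg ‖D‖)]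

theorem le_of_inexact_gradient_step {L s : ℝ} (hs : 0 ≤ s) (hsL : s * L ≤ 1)
    (hdiff : ∀ z, HasGradientAt f (f' z) z)
    (hlip : ∀ z w, ‖f' z - f' w‖ ≤ L * ‖z - w‖) (y e : H) :
    f (y - s • (f' y + e)) ≤ f y - s / 2 * ‖f' y‖ ^ 2 + s / 2 * ‖e‖ ^ 2 := by
  have h := descent_of_lipschitz_gradient hdiff hlip y (y - s • (f' y + e))
  rw [show y - s • (f' y + e) - y = -(s • (f' y + e)) by abel, norm_neg, norm_smul,
    inner_neg_right, real_inner_smul_right, inner_add_right, real_inner_self_eq_norm_sq,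
    Real.norm_of_nonneg hs] at h
  have e1 := norm_add_sq_real (f' y) e
  nlinarith [mul_nonneg (mul_nonneg hs (sub_nonneg.2 hsL)) (sq_nonneg ‖f' y + e‖)]

theorem gradient_eq_zero_of_forall_le (hdiff : ∀ z, HasGradientAt f (f' z) z) {a : H}
    (ha : ∀ z, f a ≤ f z) : f' a = 0 := by
  have h := IsLocalMin.hasFDerivAt_eq_zero (Filter.Eventually.of_forall ha) (hdiff a).hasFDerivAt
  simpa using h

end Smooth

/-- One-step decrease, up to perturbation terms, of the Lyapunov function
`‖v‖ ^ 2 / 2 + s * t ^ 2 * (f x - f xs)` of the inertial method with Hessian-driven damping. -/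
theorem lyapunov_step {H : Type*} [NormedAddCommGroup H] [InnerProductSpace ℝ H]
    {x y xs G F Mx My v : H} {s b T η fx fy fs fxn : ℝ} (hs : 0 ≤ s) (hη0 : 0 < η) (hη1 : η ≤ 1)
    (hb : b = η * s / 2) (hT1 : 1 ≤ T) (hTη : 8 ≤ T * η)
    (h1 : fxn ≤ fy - s / 2 * ‖G‖ ^ 2 + s / 2 * ‖My‖ ^ 2)
    (h2 : fy ≤ fx + inner ℝ G (y - x) - s / 2 * ‖G - F‖ ^ 2)
    (h3 : fy ≤ fs + inner ℝ G (y - xs) - s / 2 * ‖G‖ ^ 2)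
    (hv : v = x - xs + T • (y - x + b • (F + Mx))) :
    1 / 2 * ‖v - (s * T) • (G + My)‖ ^ 2 + s * T ^ 2 * (fxn - fs) ≤
      1 / 2 * ‖v‖ ^ 2 + s * (T * (T - 1)) * (fx - fs) + s * T * ‖My‖ * ‖v‖
        + s ^ 2 * T ^ 2 * (η * ‖Mx‖ ^ 2 + (4 / η + 1) * ‖My‖ ^ 2) := by
  have hT0 : 0 ≤ T := by linarith
  have hvG : inner ℝ v G = (T - 1) * inner ℝ G (y - x) + inner ℝ G (y - xs)
      + T * b * (inner ℝ G F + inner ℝ G Mx) := by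
    rw [hv, show x - xs + T • (y - x + b • (F + Mx)) =
      (T - 1) • (y - x) + (y - xs) + (T * b) • (F + Mx) by module]
    rw [real_inner_comm]
    simp only [inner_add_right, real_inner_smul_right]
  have eV : ‖v - (s * T) • (G + My)‖ ^ 2 = ‖v‖ ^ 2 - 2 * (s * T) * (inner ℝ v G + inner ℝ v My)
      + (s * T) ^ 2 * (‖G‖ ^ 2 + 2 * inner ℝ G My + ‖My‖ ^ 2) := by
    rw [norm_sub_sq_real, real_inner_smul_right, inner_add_right, norm_smul, mul_pow,
      norm_add_sq_real, Real.norm_eq_abs, sq_abs]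
    ring
  have eD := norm_sub_sq_real G F
  have iGF : |inner ℝ G F| ≤ ‖G‖ * ‖F‖ := abs_real_inner_le_norm G F
  have iGx : |inner ℝ G Mx| ≤ ‖G‖ * ‖Mx‖ := abs_real_inner_le_norm G Mx
  have iGy : inner ℝ G My ≤ ‖G‖ * ‖My‖ := real_inner_le_norm G My
  have ivy : |inner ℝ v My| ≤ ‖v‖ * ‖My‖ := abs_real_inner_le_norm v My
  rw [abs_le] at iGF iGx ivy
  have k1 := mul_le_mul_of_nonneg_left h1 (by positivity : 0 ≤ s * T ^ 2)
  have k2 := mul_le_mul_of_nonneg_left h2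
    (mul_nonneg (mul_nonneg hs hT0) (sub_nonneg.2 hT1) : 0 ≤ s * T * (T - 1))
  have k3 := mul_le_mul_of_nonneg_left h3 (mul_nonneg hs hT0 : 0 ≤ s * T)
  have kvy := mul_le_mul_of_nonneg_left ivy.1 (mul_nonneg hs hT0 : 0 ≤ s * T)
  have hq : 0 ≤ s ^ 2 * T := by positivity
  have hquad : T * ((2 - η) * inner ℝ G F - ‖G‖ ^ 2 - ‖F‖ ^ 2) + (‖F‖ ^ 2 - 2 * inner ℝ G F)
      ≤ - (T * η / 4) * (‖G‖ ^ 2 + ‖F‖ ^ 2) := by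
    have a1 : 2 * ‖G‖ * ‖F‖ ≤ ‖G‖ ^ 2 + ‖F‖ ^ 2 := two_mul_le_add_sq _ _
    have a2 : inner ℝ G F ≤ (‖G‖ ^ 2 + ‖F‖ ^ 2) / 2 := by linarith [iGF.2]
    have a3 : -inner ℝ G F ≤ (‖G‖ ^ 2 + ‖F‖ ^ 2) / 2 := by linarith [iGF.1]
    have a4 := mul_le_mul_of_nonneg_left a2
      (mul_nonneg hT0 (by linarith : 0 ≤ 2 - η))
    have a5 := mul_le_mul_of_nonneg_right hTη (by positivity : 0 ≤ ‖G‖ ^ 2 + ‖F‖ ^ 2)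
    linarith [sq_nonneg ‖G‖]
  have kq := mul_le_mul_of_nonneg_left hquad (by positivity : 0 ≤ s ^ 2 * T / 2)
  have kx : -(s ^ 2 * T ^ 2 * (η / 2) * inner ℝ G Mx) ≤
      s ^ 2 * T ^ 2 * η * (‖G‖ ^ 2 / 16 + ‖Mx‖ ^ 2) := by
    have : -inner ℝ G Mx / 2 ≤ ‖G‖ ^ 2 / 16 + ‖Mx‖ ^ 2 := by
      nlinarith [sq_nonneg (‖G‖ / 4 - ‖Mx‖), iGx.1]
    have := mul_le_mul_of_nonneg_left this (by positivity : 0 ≤ s ^ 2 * T ^ 2 * η)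
    linarith
  have ky : s ^ 2 * T ^ 2 * inner ℝ G My ≤
      s ^ 2 * T ^ 2 * (η / 16 * ‖G‖ ^ 2 + 4 / η * ‖My‖ ^ 2) := by
    refine mul_le_mul_of_nonneg_left (iGy.trans ?_) (by positivity)
    have : η / 16 * ‖G‖ ^ 2 + 4 / η * ‖My‖ ^ 2 - ‖G‖ * ‖My‖ =
        1 / η * (η / 4 * ‖G‖ - 2 * ‖My‖) ^ 2 := by
      field_simp
      ring
    have h0 : 0 ≤ 1 / η * (η / 4 * ‖G‖ - 2 * ‖My‖) ^ 2 := by positivity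
    linarith
  have kF : 0 ≤ s ^ 2 * T ^ 2 * η * ‖F‖ ^ 2 := by positivity
  rw [eV, hvG, hb]
  rw [eD] at k2
  linarith

theorem summable_sq_of_nonneg {a : ℕ → ℝ} (ha : ∀ n, 0 ≤ a n) (hs : Summable a) :
    Summable fun n => a n ^ 2 :=
  Summable.of_nonneg_of_le (fun n => sq_nonneg _)
    (fun n => by
      rw [sq]
      exact mul_le_mul_of_nonneg_right (hs.le_tsum n fun j _ => ha j) (ha n))
    (hs.mul_left (∑' i, a i))

theorem exists_forall_le_of_le_one_add_mul_add {u a c : ℕ → ℝ} {N : ℕ}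
    (hu0 : ∀ n, 0 ≤ u n) (ha0 : ∀ n, 0 ≤ a n) (hc0 : ∀ n, 0 ≤ c n)
    (ha : Summable a) (hc : Summable c)
    (hu : ∀ n ≥ N, u (n + 1) ≤ (1 + a n) * u n + c n) :
    ∃ C : ℝ, ∀ n ≥ N, u n ≤ C := by
  refine ⟨(u N + ∑' i, c i) * Real.exp (∑' i, a i), fun n hn => ?_⟩
  refine (discrete_gronwall (hu0 N) hu (fun n _ => ha0 n) (fun n _ => hc0 n) hn).trans ?_
  have h1 : ∑ i ∈ Finset.Ico N n, c i ≤ ∑' i, c i := hc.sum_le_tsum _ fun i _ => hc0 i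
  have h2 : ∑ i ∈ Finset.Ico N n, a i ≤ ∑' i, a i := ha.sum_le_tsum _ fun i _ => ha0 i
  have h3 : 0 ≤ ∑' i, c i := tsum_nonneg hc0
  gcongr
  linarith [hu0 N]

theorem exists_bound_of_norm_add_smul_sub_le {E : Type*} [NormedAddCommGroup E] [NormedSpace ℝ E]
    {p : ℕ → E} {t : ℕ → ℝ} {R : ℝ} {M : ℕ} (ht : ∀ m ≥ M, 1 ≤ t m)
    (hp : ∀ m ≥ M, ‖p m + t m • (p (m + 1) - p m)‖ ≤ R) :
    ∃ B : ℝ, ∀ m ≥ M, t m * ‖p (m + 1) - p m‖ ≤ B := by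
  have hbd : ∀ m ≥ M, ‖p m‖ ≤ max ‖p M‖ R := by
    intro m hm
    induction m, hm using Nat.le_induction with
    | base => exact le_max_left _ _
    | succ m hm ih =>
      have h1 := ht m hm
      have h2 : t m • p (m + 1) =
          (t m - 1) • p m + (p m + t m • (p (m + 1) - p m)) := by module
      have h3 := norm_add_le ((t m - 1) • p m) (p m + t m • (p (m + 1) - p m))
      rw [← h2, norm_smul, norm_smul, Real.norm_of_nonneg (by linarith),
        Real.norm_of_nonneg (by linarith)] at h3
      have h4 := mul_le_mul_of_nonneg_left ih (sub_nonneg.2 h1)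
      have h5 := (hp m hm).trans (le_max_right ‖p M‖ R)
      exact le_of_mul_le_mul_left (by linarith) (by linarith : 0 < t m)
  refine ⟨R + max ‖p M‖ R, fun m hm => ?_⟩
  have h1 := ht m hm
  have h2 := norm_sub_le (p m + t m • (p (m + 1) - p m)) (p m)
  rw [add_sub_cancel_left, norm_smul, Real.norm_of_nonneg (by linarith)] at h2
  linarith [hp m hm, hbd m hm]

theorem exists_forall_le_of_forall_ge_le {u : ℕ → ℝ} {N : ℕ} {B : ℝ} (h : ∀ n ≥ N, u n ≤ B) :
    ∃ C : ℝ, ∀ n, u n ≤ C := by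
  obtain ⟨D, hD⟩ := ((Set.finite_lt_nat N).image u).bddAbove
  refine ⟨max B D, fun n => ?_⟩
  rcases lt_or_ge n N with hn | hn
  · exact (hD ⟨n, hn, rfl⟩).trans (le_max_right _ _)
  · exact (h n hn).trans (le_max_left _ _)


/-- Theorem 2.1(iv)(a): with constant step-size, `sup_k k ‖x_k − x_{k−1}‖ < ∞`. -/
theorem igahd_velocity_bounded
    {H : Type*} [NormedAddCommGroup H] [InnerProductSpace ℝ H] [CompleteSpace H]
    (f : H → ℝ) (f' : H → H) (L : ℝ) (hL : 0 < L)
    (hconv : ConvexOn ℝ Set.univ f)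
    (hdiff : ∀ z, HasGradientAt f (f' z) z)
    (hlip : ∀ z w, ‖f' z - f' w‖ ≤ L * ‖z - w‖)
    (xstar : H) (hmin : ∀ z, f xstar ≤ f z)
    (α : ℝ) (hα : 3 < α)
    (s β : ℕ → ℝ) (hs0 : s 0 = 0) (hβ0 : β 0 = 0)
    -- constant step-size `s_k ≡ sc ∈ (0, 1/L]` and damping `β_k ≡ η √sc / 2`
    (sc : ℝ) (hsc_pos : 0 < sc) (hsc_le : sc ≤ 1 / L)
    (hs_const : ∀ k, 1 ≤ k → s k = sc)
    (η : ℝ) (hη0 : 0 < η) (hη1 : η ≤ 1)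
    (hβ : ∀ k, 1 ≤ k → β k = η * Real.sqrt sc / 2)
    (x y Mx My : ℕ → H)
    (hx_init : x 1 = x 0)
    (hy : ∀ k, 1 ≤ k → y k = x k + (1 - α / (k : ℝ)) • (x k - x (k - 1))
        - (β k * Real.sqrt (s k)) • (f' (x k) + Mx k)
        + (β (k - 1) * Real.sqrt (s (k - 1)) * (1 - 1 / (k : ℝ))) •
            (f' (x (k - 1)) + Mx (k - 1)))
    (hx : ∀ k, 1 ≤ k → x (k + 1) = y k - s k • (f' (y k) + My k))
    (hJ0x : Summable fun k : ℕ => s k * (k : ℝ) * ‖Mx k‖)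
    (hJ0y : Summable fun k : ℕ => s k * (k : ℝ) * ‖My k‖) :
    ∃ C : ℝ, ∀ k : ℕ, 1 ≤ k → (k : ℝ) * ‖x k - x (k - 1)‖ ≤ C := by
  have hα1 : 0 < α - 1 := by linarith
  have hsL : sc * L ≤ 1 := by rwa [le_div_iff₀ hL] at hsc_le
  have hW : ∀ m, sc / 2 * ‖f' (x m)‖ ^ 2 ≤ f (x m) - f xstar := by
    intro m
    have h := hconv.add_inner_gradient_add_sq_le hsc_pos.le hsL hdiff hlip (x m) xstar
    rw [gradient_eq_zero_of_forall_le hdiff hmin, inner_zero_left, zero_sub, norm_neg] at h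
    linarith
  obtain ⟨b, hb⟩ : ∃ b, b = η * sc / 2 := ⟨_, rfl⟩
  have hb0 : 0 < b := by rw [hb]; positivity
  have hbk : ∀ k, 1 ≤ k → β k * Real.sqrt (s k) = b := by
    intro k hk
    rw [hβ k hk, hs_const k hk, hb]
    linear_combination η / 2 * Real.mul_self_sqrt hsc_pos.le
  obtain ⟨t, ht⟩ : ∃ t : ℕ → ℝ, ∀ n, t n = n / (α - 1) := ⟨_, fun _ => rfl⟩
  have ht0 : ∀ n, 0 ≤ t n := fun n => by rw [ht]; positivity
  have ht_succ : ∀ n, t (n + 1) = t n + 1 / (α - 1) := fun n => by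
    rw [ht, ht]; push_cast; ring
  obtain ⟨v, hv⟩ : ∃ v : ℕ → H, ∀ n,
      v n = x n - xstar + t n • (x (n + 1) - x n + b • (f' (x n) + Mx n)) := ⟨_, fun _ => rfl⟩
  have hvy : ∀ n, v n = x (n + 1) - xstar +
      t (n + 1) • (y (n + 1) - x (n + 1) + b • (f' (x (n + 1)) + Mx (n + 1))) := by
    intro n
    have h1 : β n * Real.sqrt (s n) * (1 - 1 / ((n + 1 : ℕ) : ℝ)) =
        b * (1 - 1 / ((n + 1 : ℕ) : ℝ)) := by
      rcases Nat.eq_zero_or_pos n with rfl | hn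
      · simp
      · rw [hbk n hn]
    have hn1 : (n : ℝ) + 1 ≠ 0 := by positivity
    have e1 : t (n + 1) * (1 - α / ((n + 1 : ℕ) : ℝ)) = t n - 1 := by
      rw [ht, ht]; push_cast; field_simp; ring
    have e2 : t (n + 1) * (b * (1 - 1 / ((n + 1 : ℕ) : ℝ))) = t n * b := by
      rw [ht, ht]; push_cast; field_simp; ring
    have h2 := hy (n + 1) (Nat.le_add_left 1 n)
    rw [Nat.add_sub_cancel, h1, hbk (n + 1) (Nat.le_add_left 1 n)] at h2
    have h3 : t (n + 1) • (y (n + 1) - x (n + 1) + b • (f' (x (n + 1)) + Mx (n + 1))) =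
        (t (n + 1) * (1 - α / ((n + 1 : ℕ) : ℝ))) • (x (n + 1) - x n) +
        (t (n + 1) * (b * (1 - 1 / ((n + 1 : ℕ) : ℝ)))) • (f' (x n) + Mx n) := by
      rw [h2]; module
    rw [h3, e1, e2, hv]
    module
  have hvs : ∀ n, v (n + 1) = v n - (sc * t (n + 1)) • (f' (y (n + 1)) + My (n + 1)) := by
    intro n
    rw [hv (n + 1), hvy n, hx (n + 1) (Nat.le_add_left 1 n), hs_const (n + 1) (Nat.le_add_left 1 n)]
    module
  have hsum : ∀ M : ℕ → H, Summable (fun k : ℕ => s k * (k : ℝ) * ‖M k‖) →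
      Summable fun n => sc * t (n + 1) * ‖M (n + 1)‖ := by
    intro M hM
    refine (((summable_nat_add_iff 1).2 hM).mul_left (1 / (α - 1))).congr fun n => ?_
    rw [hs_const (n + 1) (Nat.le_add_left 1 n), ht]
    ring
  have hsx := hsum Mx hJ0x
  have hsy := hsum My hJ0y
  have hnn : ∀ (M : ℕ → H) n, 0 ≤ sc * t (n + 1) * ‖M (n + 1)‖ := fun M n =>
    mul_nonneg (mul_nonneg hsc_pos.le (ht0 _)) (norm_nonneg _)
  obtain ⟨N, hN⟩ := exists_nat_ge (8 * (α - 1) / η)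
  have htN : ∀ n ≥ N, 8 ≤ t n * η := by
    intro n hn
    have h1 : 8 * (α - 1) / η ≤ n := hN.trans (Nat.cast_le.2 hn)
    rw [div_le_iff₀ hη0] at h1
    rw [ht, div_mul_eq_mul_div, le_div_iff₀ hα1]
    exact h1
  have htN1 : ∀ n ≥ N, 1 ≤ t n := by
    intro n hn
    have := mul_le_of_le_one_right (ht0 n) hη1
    linarith [htN n hn]
  have ht2 : ∀ n ≥ N, t (n + 1) ≤ 2 * t n := by
    intro n hn
    have : 1 / (α - 1) ≤ 1 := by rw [div_le_one hα1]; linarith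
    linarith [htN1 n hn, ht_succ n]
  obtain ⟨u, hu⟩ : ∃ u : ℕ → ℝ, ∀ n,
      u n = 1 / 2 * ‖v n‖ ^ 2 + sc * t n ^ 2 * (f (x (n + 1)) - f xstar) := ⟨_, fun _ => rfl⟩
  have hfun : ∀ n, 0 ≤ sc * t n ^ 2 * (f (x (n + 1)) - f xstar) := fun n =>
    mul_nonneg (by positivity) (sub_nonneg.2 (hmin _))
  have hstep : ∀ n ≥ N, u (n + 1) ≤ (1 + sc * t (n + 1) * ‖My (n + 1)‖) * u n +
      (sc * t (n + 1) * ‖My (n + 1)‖ + (η * (sc * t (n + 1) * ‖Mx (n + 1)‖) ^ 2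
        + (4 / η + 1) * (sc * t (n + 1) * ‖My (n + 1)‖) ^ 2)) := by
    intro n hn
    have h3 := hconv.add_inner_gradient_add_sq_le hsc_pos.le hsL hdiff hlip xstar (y (n + 1))
    rw [gradient_eq_zero_of_forall_le hdiff hmin, sub_zero] at h3
    have h := lyapunov_step hsc_pos.le hη0 hη1 hb (htN1 _ (Nat.le_succ_of_le hn))
      (htN _ (Nat.le_succ_of_le hn))
      (le_of_inexact_gradient_step hsc_pos.le hsL hdiff hlip (y (n + 1)) (My (n + 1)))
      (hconv.add_inner_gradient_add_sq_le hsc_pos.le hsL hdiff hlip (x (n + 1)) (y (n + 1)))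
      h3 (hvy n)
    have hx' := hx (n + 1) (Nat.le_add_left 1 n)
    rw [hs_const (n + 1) (Nat.le_add_left 1 n)] at hx'
    rw [← hvs, ← hx'] at h
    have hTt : t (n + 1) * (t (n + 1) - 1) ≤ t n ^ 2 := by
      have hr1 : 1 / (α - 1) ≤ 1 / 2 := by
        rw [div_le_div_iff₀ hα1 two_pos]; linarith
      have hr0 : 0 < 1 / (α - 1) := by positivity
      rw [ht_succ]
      nlinarith [ht0 n]
    have hWT := mul_le_mul_of_nonneg_right (mul_le_mul_of_nonneg_left hTt hsc_pos.le)
      (sub_nonneg.2 (hmin (x (n + 1))))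
    have hva : sc * t (n + 1) * ‖My (n + 1)‖ * ‖v n‖ ≤
        sc * t (n + 1) * ‖My (n + 1)‖ * (1 + u n) := by
      refine mul_le_mul_of_nonneg_left ?_ (hnn My n)
      rw [hu]
      nlinarith [hfun n, sq_nonneg (‖v n‖ - 1)]
    have hun := hu n
    rw [hu (n + 1)]
    linarith
  obtain ⟨C, hC⟩ := exists_forall_le_of_le_one_add_mul_add
    (fun n => by rw [hu]; exact add_nonneg (by positivity) (hfun n))
    (hnn My)
    (fun n => add_nonneg (hnn My n) (by positivity))
    hsy
    (hsy.add (((summable_sq_of_nonneg (hnn Mx) hsx).mul_left η).add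
      ((summable_sq_of_nonneg (hnn My) hsy).mul_left (4 / η + 1)))) hstep
  have hvb : ∀ n ≥ N, ‖v n‖ ≤ Real.sqrt (2 * C) := by
    intro n hn
    refine Real.le_sqrt_of_sq_le ?_
    have := hC n hn
    rw [hu] at this
    linarith [hfun n]
  have hgb : ∀ n ≥ N, sc * t n * ‖f' (x (n + 1))‖ ≤ Real.sqrt (2 * C) := by
    intro n hn
    refine Real.le_sqrt_of_sq_le ?_
    have h1 := hC n hn
    rw [hu] at h1
    have h2 := mul_le_mul_of_nonneg_left (hW (n + 1)) (by positivity : 0 ≤ sc * t n ^ 2)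
    nlinarith [sq_nonneg ‖v n‖]
  have hq : ∀ m ≥ N + 1, ‖(x m - xstar) + t m • ((x (m + 1) - xstar) - (x m - xstar))‖ ≤
      Real.sqrt (2 * C) + b / sc * (2 * Real.sqrt (2 * C) +
        ∑' n, sc * t (n + 1) * ‖Mx (n + 1)‖) := by
    intro m hm
    obtain ⟨n, rfl⟩ : ∃ n, m = n + 1 := ⟨m - 1, by omega⟩
    have hn : N ≤ n := by omega
    have e : (x (n + 1) - xstar) + t (n + 1) • ((x (n + 1 + 1) - xstar) - (x (n + 1) - xstar)) =
        v (n + 1) - (b / sc) • ((sc * t (n + 1)) • f' (x (n + 1)) +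
          (sc * t (n + 1)) • Mx (n + 1)) := by
      rw [hv, ← smul_add, smul_smul, show b / sc * (sc * t (n + 1)) = t (n + 1) * b by field_simp]
      module
    have hst : 0 ≤ sc * t (n + 1) := mul_nonneg hsc_pos.le (ht0 _)
    rw [e]
    refine (norm_sub_le _ _).trans (add_le_add (hvb _ (by omega)) ?_)
    rw [norm_smul, Real.norm_of_nonneg (by positivity)]
    refine mul_le_mul_of_nonneg_left ((norm_add_le _ _).trans (add_le_add ?_ ?_)) (by positivity)
    · rw [norm_smul, Real.norm_of_nonneg hst]
      have h1 := mul_le_mul_of_nonneg_right (mul_le_mul_of_nonneg_left (ht2 n hn) hsc_pos.le)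
        (norm_nonneg (f' (x (n + 1))))
      linarith [hgb n hn]
    · rw [norm_smul, Real.norm_of_nonneg hst]
      exact hsx.le_tsum n fun j _ => hnn Mx j
  obtain ⟨B, hB⟩ := exists_bound_of_norm_add_smul_sub_le (p := fun m => x m - xstar)
    (fun m hm => htN1 m (Nat.le_of_succ_le hm)) hq
  have hlarge : ∀ k ≥ N + 2, (k : ℝ) * ‖x k - x (k - 1)‖ ≤ (α - 1) * (2 * B) := by
    intro k hk
    obtain ⟨m, rfl⟩ : ∃ m, k = m + 1 := ⟨k - 1, by omega⟩
    have h1 := hB m (by omega)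
    rw [sub_sub_sub_cancel_right] at h1
    have h2 : ((m + 1 : ℕ) : ℝ) = (α - 1) * t (m + 1) := by rw [ht]; field_simp
    rw [Nat.add_sub_cancel, h2, mul_assoc]
    refine mul_le_mul_of_nonneg_left ?_ hα1.le
    have h3 := mul_le_mul_of_nonneg_right (ht2 m (by omega)) (norm_nonneg (x (m + 1) - x m))
    linarith
  obtain ⟨D, hD⟩ := exists_forall_le_of_forall_ge_le hlarge
  exact ⟨D, fun k _ => hD k⟩
end
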